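/- Let A be a regular Hopf coquasigroup over a field k with a faithful left integral φ, let σ be the modular automorphism with φ(ab) = φ(b·σ(a)) for all a, b ∈ A, and let σ' be the modular automorphism of ψ = φ∘S with ψ(ab) = ψ(b·σ'(a)) for all a, b ∈ A. Then σ∘σ' = σ'∘σ, and both σ and σ' commute with S²: σ∘S² = S²∘σ and σ'∘S² = S²∘σ'. -/

import Mathlib

open TensorProduct

/-- A regular Hopf coquasigroup over a field `k`: a unital associative `k`-algebra `A`
with a (not necessarily coassociative) coproduct `comul : A →ₐ[k] A ⊗[k] A`, a counit
`counit : A →ₐ[k] k`, and a bijective antipode `antipode : A ≃ₗ[k] A` which is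
antimultiplicative, anticomultiplicative, and satisfies the quasigroup antipode
identities. -/
structure RegularHopfCoquasigroup (k A : Type*) [Field k] [Ring A] [Algebra k A] where
  comul : A →ₐ[k] A ⊗[k] A
  counit : A →ₐ[k] k
  antipode : A ≃ₗ[k] A
  /-- `(ε ⊗ id) ∘ Δ = id` -/
  counit_comul_left : ∀ a : A,
    (TensorProduct.lid k A) ((LinearMap.rTensor A counit.toLinearMap) (comul a)) = a
  /-- `(id ⊗ ε) ∘ Δ = id` -/
  counit_comul_right : ∀ a : A,
    (TensorProduct.rid k A) ((LinearMap.lTensor A counit.toLinearMap) (comul a)) = a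
  /-- `S(ab) = S(b)S(a)` -/
  antipode_mul : ∀ a b : A, antipode (a * b) = antipode b * antipode a
  /-- `S(1) = 1` -/
  antipode_one : antipode (1 : A) = 1
  /-- `Δ ∘ S = (S ⊗ S) ∘ flip ∘ Δ` -/
  antipode_comul : ∀ a : A,
    comul (antipode a) =
      (TensorProduct.map antipode.toLinearMap antipode.toLinearMap)
        ((TensorProduct.comm k A A) (comul a))
  /-- `S(a₍₁₎)a₍₂₎₍₁₎ ⊗ a₍₂₎₍₂₎ = 1 ⊗ a` -/
  quasi₁ : ∀ a : A,
    (LinearMap.rTensor A (LinearMap.mul' k A))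
      ((TensorProduct.assoc k A A A).symm
        ((LinearMap.rTensor (A ⊗[k] A) antipode.toLinearMap)
          ((LinearMap.lTensor A comul.toLinearMap) (comul a)))) = (1 : A) ⊗ₜ[k] a
  /-- `a₍₁₎S(a₍₂₎₍₁₎) ⊗ a₍₂₎₍₂₎ = 1 ⊗ a` -/
  quasi₂ : ∀ a : A,
    (LinearMap.rTensor A (LinearMap.mul' k A))
      ((TensorProduct.assoc k A A A).symm
        ((LinearMap.lTensor A (LinearMap.rTensor A antipode.toLinearMap))
          ((LinearMap.lTensor A comul.toLinearMap) (comul a)))) = (1 : A) ⊗ₜ[k] a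
  /-- `a₍₁₎₍₁₎ ⊗ S(a₍₁₎₍₂₎)a₍₂₎ = a ⊗ 1` -/
  quasi₃ : ∀ a : A,
    (LinearMap.lTensor A (LinearMap.mul' k A))
      ((TensorProduct.assoc k A A A)
        ((LinearMap.rTensor A (LinearMap.lTensor A antipode.toLinearMap))
          ((LinearMap.rTensor A comul.toLinearMap) (comul a)))) = a ⊗ₜ[k] (1 : A)
  /-- `a₍₁₎₍₁₎ ⊗ a₍₁₎₍₂₎S(a₍₂₎) = a ⊗ 1` -/
  quasi₄ : ∀ a : A,
    (LinearMap.lTensor A (LinearMap.mul' k A))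
      ((TensorProduct.assoc k A A A)
        ((LinearMap.lTensor (A ⊗[k] A) antipode.toLinearMap)
          ((LinearMap.rTensor A comul.toLinearMap) (comul a)))) = a ⊗ₜ[k] (1 : A)

variable {k A : Type*} [Field k] [Ring A] [Algebra k A]

/-- `(id ⊗ f)` on `A ⊗[k] A`, composed with `A ⊗ k ≅ A`; so `idT f (a ⊗ b) = f b • a`,
i.e. in Sweedler notation `idT f (Δ a) = a₍₁₎ f(a₍₂₎)`. -/
noncomputable def idT (f : A →ₗ[k] k) : A ⊗[k] A →ₗ[k] A :=
  (TensorProduct.rid k A).toLinearMap ∘ₗ LinearMap.lTensor A f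

/-- `(f ⊗ id)` on `A ⊗[k] A`, composed with `k ⊗ A ≅ A`; so `Tid f (a ⊗ b) = f a • b`,
i.e. in Sweedler notation `Tid f (Δ a) = f(a₍₁₎) a₍₂₎`. -/
noncomputable def Tid (f : A →ₗ[k] k) : A ⊗[k] A →ₗ[k] A :=
  (TensorProduct.lid k A).toLinearMap ∘ₗ LinearMap.rTensor A f

/-- A linear functional `f` on `A` is faithful if `f(a·) = 0` implies `a = 0` and
`f(·a) = 0` implies `a = 0`. -/
def Faithful (f : A →ₗ[k] k) : Prop :=
  (∀ a : A, (∀ b : A, f (a * b) = 0) → a = 0) ∧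
  (∀ a : A, (∀ b : A, f (b * a) = 0) → a = 0)

/-- A left integral: a nonzero functional `φ` with `a₍₁₎ φ(a₍₂₎) = φ(a)·1`. -/
def IsLeftIntegral (H : RegularHopfCoquasigroup k A) (φ : A →ₗ[k] k) : Prop :=
  φ ≠ 0 ∧ ∀ a : A, idT φ (H.comul a) = φ a • (1 : A)

/-- A right integral: a nonzero functional `ψ` with `ψ(a₍₁₎) a₍₂₎ = ψ(a)·1`. -/
def IsRightIntegral (H : RegularHopfCoquasigroup k A) (ψ : A →ₗ[k] k) : Prop :=
  ψ ≠ 0 ∧ ∀ a : A, Tid ψ (H.comul a) = ψ a • (1 : A)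


@[simp]
theorem idT_tmul (f : A →ₗ[k] k) (x y : A) : idT f (x ⊗ₜ[k] y) = f y • x := by
  simp [idT]

@[simp]
theorem Tid_tmul (f : A →ₗ[k] k) (x y : A) : Tid f (x ⊗ₜ[k] y) = f x • y := by
  simp [Tid]

theorem idT_tmul_one_mul (f : A →ₗ[k] k) (x : A) (u : A ⊗[k] A) :
    idT f (x ⊗ₜ[k] 1 * u) = x * idT f u := by
  induction u with
  | zero => simp
  | tmul y z => simp
  | add y z hy hz => simp [mul_add, hy, hz]

theorem apply_idT (f g : A →ₗ[k] k) (t : A ⊗[k] A) : g (idT f t) = f (Tid g t) := by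
  induction t with
  | zero => simp
  | tmul x y => simp [mul_comm]
  | add x y hx hy => simp [hx, hy]

theorem eq_zero_of_Tid_eq_zero {t : A ⊗[k] A} (h : ∀ g : A →ₗ[k] k, Tid g t = 0) : t = 0 := by
  classical
  let b := Module.Basis.ofVectorSpace k A
  apply (TensorProduct.equivFinsuppOfBasisLeft (N := A) b).injective
  ext i
  rw [TensorProduct.equivFinsuppOfBasisLeft_apply]
  simpa [Tid] using h (b.coord i)

/-- Functionals `φ(b·)` with `φ` faithful separate the second tensor leg. -/
theorem Faithful.tensor_ext {φ : A →ₗ[k] k} (hf : Faithful φ) {s t : A ⊗[k] A}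
    (h : ∀ b : A, idT (φ ∘ₗ LinearMap.mulLeft k b) s = idT (φ ∘ₗ LinearMap.mulLeft k b) t) :
    s = t := by
  rw [← sub_eq_zero]
  refine eq_zero_of_Tid_eq_zero fun g => hf.2 _ fun b => ?_
  have := apply_idT (φ ∘ₗ LinearMap.mulLeft k b) g (s - t)
  rw [map_sub, h b, sub_self, map_zero] at this
  simpa using this.symm

namespace RegularHopfCoquasigroup

variable (H : RegularHopfCoquasigroup k A)

theorem comul_injective : Function.Injective H.comul := fun a b h => by
  rw [← H.counit_comul_left a, h, H.counit_comul_left]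

/-- `S(a₍₁₎) φ(a₍₂₎ b) = b₍₁₎ φ(a b₍₂₎)` for a left integral `φ`. -/
theorem antipode_idT_comul {φ : A →ₗ[k] k}
    (hφ : ∀ a : A, idT φ (H.comul a) = φ a • (1 : A)) (a b : A) :
    H.antipode (idT (φ ∘ₗ LinearMap.mulRight k b) (H.comul a)) =
      idT (φ ∘ₗ LinearMap.mulLeft k a) (H.comul b) := by
  have mul_assoc_symm (x : A) (u : A ⊗[k] A) :
      LinearMap.rTensor A (LinearMap.mul' k A) ((TensorProduct.assoc k A A A).symm (x ⊗ₜ[k] u)) =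
        x ⊗ₜ[k] 1 * u := by
    induction u with
    | zero => simp
    | tmul y z => simp
    | add y z hy hz => simp only [TensorProduct.tmul_add, map_add, hy, hz, mul_add]
  have contract (t : A ⊗[k] A) :
      idT φ (LinearMap.rTensor A (LinearMap.mul' k A)
        ((TensorProduct.assoc k A A A).symm
          ((LinearMap.rTensor (A ⊗[k] A) H.antipode.toLinearMap)
            ((LinearMap.lTensor A H.comul.toLinearMap) t))) * H.comul b) =
      H.antipode (idT (φ ∘ₗ LinearMap.mulRight k b) t) := by
    induction t with
    | zero => simp
    | tmul x y =>
      rw [LinearMap.lTensor_tmul, LinearMap.rTensor_tmul, mul_assoc_symm, AlgHom.toLinearMap_apply,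
        mul_assoc, ← map_mul, idT_tmul_one_mul, hφ]
      simp
    | add x y hx hy => simp only [map_add, add_mul, hx, hy]
  have unit_leg (t : A ⊗[k] A) :
      idT φ ((1 : A) ⊗ₜ[k] a * t) = idT (φ ∘ₗ LinearMap.mulLeft k a) t := by
    induction t with
    | zero => simp
    | tmul y z => simp
    | add y z hy hz => simp [mul_add, hy, hz]
  rw [← contract, H.quasi₁, unit_leg]

/-- `φ(ψ(S(a₍₁₎)) a₍₂₎ b) = φ(a) ψ(b)` for a left integral `φ` and a right integral `ψ`. -/
theorem apply_Tid_comul_mul {φ ψ : A →ₗ[k] k}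
    (hφ : ∀ a : A, idT φ (H.comul a) = φ a • (1 : A))
    (hψ : ∀ a : A, Tid ψ (H.comul a) = ψ a • (1 : A)) (a b : A) :
    φ (Tid (ψ ∘ₗ H.antipode.toLinearMap) (H.comul a) * b) = φ a * ψ b := by
  have key := congrArg ψ (H.antipode_idT_comul hφ a b)
  rw [apply_idT, hψ] at key
  have swap := apply_idT (φ ∘ₗ LinearMap.mulRight k b) (ψ ∘ₗ H.antipode.toLinearMap) (H.comul a)
  simp only [LinearMap.comp_apply, LinearMap.mulRight_apply, LinearMap.mulLeft_apply,
    LinearEquiv.coe_coe, map_smul, smul_eq_mul, mul_one] at key swap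
  rw [← swap, key, mul_comm]

theorem idT_comul_antipode (f : A →ₗ[k] k) (a : A) :
    idT f (H.comul (H.antipode a)) =
      H.antipode (Tid (f ∘ₗ H.antipode.toLinearMap) (H.comul a)) := by
  rw [H.antipode_comul]
  induction H.comul a with
  | zero => simp
  | tmul x y => simp
  | add x y hx hy => simp [hx, hy]

theorem Tid_comul_antipode (f : A →ₗ[k] k) (a : A) :
    Tid f (H.comul (H.antipode a)) =
      H.antipode (idT (f ∘ₗ H.antipode.toLinearMap) (H.comul a)) := by
  rw [H.antipode_comul]
  induction H.comul a with
  | zero => simp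
  | tmul x y => simp
  | add x y hx hy => simp [hx, hy]

end RegularHopfCoquasigroup

variable {H : RegularHopfCoquasigroup k A} {φ : A →ₗ[k] k}

theorem IsLeftIntegral.comp_antipode (hφ : IsLeftIntegral H φ) :
    IsRightIntegral H (φ ∘ₗ H.antipode.toLinearMap) := by
  refine ⟨fun h => hφ.1 ?_, fun a => H.antipode.injective ?_⟩
  · ext a
    simpa using LinearMap.congr_fun h (H.antipode.symm a)
  · rw [← H.idT_comul_antipode, hφ.2]
    simp [H.antipode_one]

theorem IsRightIntegral.comp_antipode {ψ : A →ₗ[k] k} (hψ : IsRightIntegral H ψ) :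
    IsLeftIntegral H (ψ ∘ₗ H.antipode.toLinearMap) := by
  refine ⟨fun h => hψ.1 ?_, fun a => H.antipode.injective ?_⟩
  · ext a
    simpa using LinearMap.congr_fun h (H.antipode.symm a)
  · rw [← H.Tid_comul_antipode, hψ.2]
    simp [H.antipode_one]

/-- Uniqueness of left integrals, in the presence of a faithful one. -/
theorem IsLeftIntegral.exists_eq_smul (hφ : IsLeftIntegral H φ) (hf : Faithful φ)
    {φ' : A →ₗ[k] k} (hφ' : IsLeftIntegral H φ') : ∃ τ : k, φ' = τ • φ := by
  have hψ := hφ.comp_antipode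
  set ψ := φ ∘ₗ H.antipode.toLinearMap
  obtain ⟨a₀, ha₀⟩ := DFunLike.ne_iff.1 hφ.1
  obtain ⟨b, hb⟩ := DFunLike.ne_iff.1 hψ.1
  rw [LinearMap.zero_apply] at ha₀ hb
  let δ : A → A := fun a => Tid (ψ ∘ₗ H.antipode.toLinearMap) (H.comul a)
  have hδ (a : A) : φ a₀ • δ a = φ a • δ a₀ := by
    rw [← sub_eq_zero]
    refine hf.1 _ fun c => ?_
    rw [sub_mul, smul_mul_assoc, smul_mul_assoc, map_sub, map_smul, map_smul,
      H.apply_Tid_comul_mul hφ.2 hψ.2, H.apply_Tid_comul_mul hφ.2 hψ.2]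
    simp only [smul_eq_mul]
    ring
  refine ⟨φ' a₀ / φ a₀, LinearMap.ext fun a => ?_⟩
  have h := congrArg (fun x => φ' (x * b)) (hδ a)
  simp only [smul_mul_assoc, map_smul, smul_eq_mul, δ,
    H.apply_Tid_comul_mul hφ'.2 hψ.2] at h
  have h' : φ a₀ * φ' a = φ a * φ' a₀ := mul_right_cancel₀ hb (by rw [mul_assoc, h, mul_assoc])
  rw [LinearMap.smul_apply, smul_eq_mul, div_mul_eq_mul_div, eq_div_iff ha₀, mul_comm, h',
    mul_comm]

/-- A modular automorphism `σ` of a faithful functional `f` commutes with every multiplicative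
bijection scaling `f`. -/
theorem Faithful.modular_comm {f : A →ₗ[k] k} (hf : Faithful f) {σ : A → A}
    (hσ : ∀ a b : A, f (a * b) = f (b * σ a)) {T : A → A} (hT : Function.Surjective T)
    (T_mul : ∀ a b : A, T (a * b) = T a * T b) {τ : k} (hτ : ∀ a : A, f (T a) = τ * f a) (a : A) :
    σ (T a) = T (σ a) := by
  rw [← sub_eq_zero]
  refine hf.2 _ fun c => ?_
  obtain ⟨b, rfl⟩ := hT c
  rw [mul_sub, map_sub, ← hσ, ← T_mul, ← T_mul, hτ, hτ, hσ, sub_self]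

/-- `Δ(σ(a)) = (S² ⊗ σ)(Δ(a))`. -/
theorem IsLeftIntegral.comul_modular (hφ : IsLeftIntegral H φ) (hf : Faithful φ) {σ : A →ₗ[k] A}
    (hσ : ∀ a b : A, φ (a * b) = φ (b * σ a)) (a : A) :
    H.comul (σ a) = TensorProduct.map (H.antipode.toLinearMap ∘ₗ H.antipode.toLinearMap) σ
      (H.comul a) := by
  refine hf.tensor_ext fun b => ?_
  have hL : φ ∘ₗ LinearMap.mulRight k (σ a) = φ ∘ₗ LinearMap.mulLeft k a := by
    ext c
    simp [hσ a c]
  rw [← H.antipode_idT_comul hφ.2, hL, ← H.antipode_idT_comul hφ.2]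
  induction H.comul a with
  | zero => simp
  | tmul x y => simp [hσ y b]
  | add x y hx hy => simp only [map_add, hx, hy]

/-- the modular automorphisms `σ` and `σ'` commute with each other
and with `S²`. -/
theorem stmt_15 (k A : Type*) [Field k] [Ring A] [Algebra k A]
    (H : RegularHopfCoquasigroup k A) (φ : A →ₗ[k] k)
    (hφ : IsLeftIntegral H φ) (hf : Faithful φ)
    (σ : A ≃ₐ[k] A) (hσ : ∀ a b : A, φ (a * b) = φ (b * σ a))
    (σ' : A ≃ₐ[k] A)
    (hσ' : ∀ a b : A, φ (H.antipode (a * b)) = φ (H.antipode (b * σ' a))) :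
    (∀ a : A, σ (σ' a) = σ' (σ a)) ∧
    (∀ a : A, σ (H.antipode (H.antipode a)) = H.antipode (H.antipode (σ a))) ∧
    (∀ a : A, σ' (H.antipode (H.antipode a)) = H.antipode (H.antipode (σ' a))) := by
  have S2_mul (a b : A) : H.antipode (H.antipode (a * b)) =
      H.antipode (H.antipode a) * H.antipode (H.antipode b) := by
    rw [H.antipode_mul, H.antipode_mul]
  have S2_surj : Function.Surjective fun a => H.antipode (H.antipode a) :=
    H.antipode.surjective.comp H.antipode.surjective
  obtain ⟨τ, hτ⟩ := hφ.exists_eq_smul hf hφ.comp_antipode.comp_antipode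
  have φ_S2 (a : A) : φ (H.antipode (H.antipode a)) = τ * φ a := by
    simpa using LinearMap.congr_fun hτ a
  have σ_S2 : ∀ a : A, σ (H.antipode (H.antipode a)) = H.antipode (H.antipode (σ a)) :=
    hf.modular_comm hσ S2_surj S2_mul φ_S2
  have σ_S_σ' (a : A) : σ (H.antipode (σ' a)) = H.antipode a := by
    rw [← sub_eq_zero]
    refine hf.2 _ fun c => ?_
    obtain ⟨b, rfl⟩ := H.antipode.surjective c
    rw [mul_sub, map_sub, ← hσ, ← H.antipode_mul, ← H.antipode_mul, ← hσ', sub_self]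
  have σ'_S2 (a : A) : σ' (H.antipode (H.antipode a)) = H.antipode (H.antipode (σ' a)) := by
    apply H.antipode.injective
    apply σ.injective
    rw [σ_S_σ', σ_S2, σ_S_σ']
  refine ⟨fun a => ?_, σ_S2, σ'_S2⟩
  let P : A ⊗[k] A ≃ₗ[k] A ⊗[k] A :=
    TensorProduct.congr (.refl k A) (H.antipode.trans H.antipode)
  let Q : A ⊗[k] A ≃ₗ[k] A ⊗[k] A :=
    (TensorProduct.comm k A A).trans
      (TensorProduct.congr H.antipode (H.antipode.trans σ.toLinearEquiv))
  let S := H.antipode.toLinearMap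
  have comul_σ (a : A) : H.comul (σ a) = TensorProduct.map (S ∘ₗ S) σ.toLinearMap (H.comul a) :=
    hφ.comul_modular hf (σ := σ.toLinearMap) hσ a
  have comul_σ' (a : A) : P (H.comul (σ' a)) =
      TensorProduct.map σ'.toLinearMap LinearMap.id (H.comul a) := by
    have hQ (t : A ⊗[k] A) : Q (TensorProduct.map σ'.toLinearMap LinearMap.id t) =
        TensorProduct.map S S (TensorProduct.comm k A A t) := by
      induction t with
      | zero => simp
      | tmul x y => simp [Q, S, σ_S_σ']
      | add x y hx hy => simp only [map_add, hx, hy]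
    have hQP (t : A ⊗[k] A) : Q (P t) = TensorProduct.map (S ∘ₗ S) σ.toLinearMap
        (TensorProduct.map S S (TensorProduct.comm k A A t)) := by
      induction t with
      | zero => simp
      | tmul x y => simp [P, Q, S]
      | add x y hx hy => simp only [map_add, hx, hy]
    apply Q.injective
    rw [hQ, hQP, ← H.antipode_comul, ← H.antipode_comul, ← comul_σ, σ_S_σ']
  have hP (t : A ⊗[k] A) : P (TensorProduct.map (S ∘ₗ S) σ.toLinearMap t) =
      TensorProduct.map (S ∘ₗ S) σ.toLinearMap (P t) := by
    induction t with
    | zero => simp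
    | tmul x y => simp [P, S, σ_S2]
    | add x y hx hy => simp only [map_add, hx, hy]
  apply H.comul_injective
  apply P.injective
  rw [comul_σ, hP, comul_σ', comul_σ', comul_σ]
  induction H.comul a with
  | zero => simp
  | tmul x y => simp [S, σ'_S2]
  | add x y hx hy => simp only [map_add, hx, hy]
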